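/- Fix an integer n ≥ 2 and let E_{2,n}(x_1,…,x_n) = Σ_{1 ≤ i < j ≤ n} x_i x_j. Then the function E_{2,n}^{-β} is completely monotone on (0,∞)^n if and only if β = 0 or β ≥ (n−2)/2. -/

import Mathlib

/-- The open positive orthant `(0,∞)^ι`. -/
def posOrthant (ι : Type*) : Set (ι → ℝ) := {x | ∀ i, 0 < x i}

/-- A function `f : (0,∞)^ι → ℝ` is completely monotone if it is `C^∞` on the open
orthant and `(−1)^k ∂^k f/(∂x_{i_1}···∂x_{i_k}) ≥ 0` there, for every `k ≥ 0` and all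
indices `i_1, …, i_k`. -/
def CompletelyMonotoneOnOrthant {ι : Type*} [Fintype ι] [DecidableEq ι]
    (f : (ι → ℝ) → ℝ) : Prop :=
  ContDiffOn ℝ (⊤ : ℕ∞) f (posOrthant ι) ∧
    ∀ (k : ℕ) (idx : Fin k → ι), ∀ x ∈ posOrthant ι,
      0 ≤ (-1 : ℝ) ^ k *
        iteratedFDerivWithin ℝ k f (posOrthant ι) x (fun j => Pi.single (idx j) (1 : ℝ))

/-- The elementary symmetric polynomial of degree 2 in `n` variables,
`E_{2,n}(x) = ∑_{1 ≤ i < j ≤ n} x_i x_j`. -/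
def E2 (n : ℕ) (x : Fin n → ℝ) : ℝ :=
  ∑ p ∈ Finset.univ.filter (fun p : Fin n × Fin n => p.1 < p.2), x p.1 * x p.2

open MeasureTheory Filter Topology
open scoped Polynomial

section DifferenceMonotone

variable {ι : Type*} [DecidableEq ι]

/-- The backward difference operator `f ↦ f - f(· + h e_i)` as a linear map. -/
noncomputable def backDiff (h : ℝ) (i : ι) : Module.End ℝ ((ι → ℝ) → ℝ) where
  toFun f := fun x => f x - f (x + Pi.single i h)
  map_add' _ _ := by ext x; simp only [Pi.add_apply]; ring
  map_smul' _ _ := by ext x; simp only [Pi.smul_apply, smul_eq_mul, RingHom.id_apply]; ring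

/-- The shift operator `f ↦ f(· + h e_i)` as a linear map. -/
noncomputable def shiftOp (h : ℝ) (i : ι) : Module.End ℝ ((ι → ℝ) → ℝ) where
  toFun f := fun x => f (x + Pi.single i h)
  map_add' _ _ := rfl
  map_smul' _ _ := rfl

/-- All `k`-fold backward differences of `f` are nonnegative on the open orthant. -/
def DiffNonneg : ℕ → ((ι → ℝ) → ℝ) → Prop
  | 0, f => ∀ x ∈ posOrthant ι, 0 ≤ f x
  | k + 1, f => ∀ (i : ι) (h : ℝ), 0 < h → DiffNonneg k (backDiff h i f)

/-- Backward differences of every order are nonnegative on the open orthant. -/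
def DiffMonotone (f : (ι → ℝ) → ℝ) : Prop := ∀ k, DiffNonneg k f

omit [DecidableEq ι] in
theorem add_mem_posOrthant {x y : ι → ℝ} (hx : x ∈ posOrthant ι) (hy : ∀ i, 0 ≤ y i) :
    x + y ∈ posOrthant ι := fun i => add_pos_of_pos_of_nonneg (hx i) (hy i)

theorem add_single_mem_posOrthant {x : ι → ℝ} (hx : x ∈ posOrthant ι) (i : ι) {h : ℝ}
    (hh : 0 ≤ h) : x + Pi.single i h ∈ posOrthant ι := by
  refine add_mem_posOrthant hx fun j => ?_
  by_cases hj : j = i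
  · subst hj; simpa using hh
  · simp [hj]

theorem DiffNonneg.congr {k : ℕ} {f g : (ι → ℝ) → ℝ} (hf : DiffNonneg k f)
    (hfg : ∀ x ∈ posOrthant ι, f x = g x) : DiffNonneg k g := by
  induction k generalizing f g with
  | zero => exact fun x hx => hfg x hx ▸ hf x hx
  | succ k ih =>
    intro i h hh
    refine ih (hf i h hh) fun x hx => ?_
    change f x - f _ = g x - g _
    rw [hfg x hx, hfg _ (add_single_mem_posOrthant hx i hh.le)]

theorem DiffNonneg.add {k : ℕ} {f g : (ι → ℝ) → ℝ} (hf : DiffNonneg k f)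
    (hg : DiffNonneg k g) : DiffNonneg k (f + g) := by
  induction k generalizing f g with
  | zero => exact fun x hx => add_nonneg (hf x hx) (hg x hx)
  | succ k ih =>
    intro i h hh
    rw [map_add]
    exact ih (hf i h hh) (hg i h hh)

theorem DiffNonneg.smul {k : ℕ} {f : (ι → ℝ) → ℝ} (hf : DiffNonneg k f) {c : ℝ}
    (hc : 0 ≤ c) : DiffNonneg k (c • f) := by
  induction k generalizing f with
  | zero => exact fun x hx => mul_nonneg hc (hf x hx)
  | succ k ih =>
    intro i h hh
    rw [map_smul]
    exact ih (hf i h hh)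

theorem DiffNonneg.of_tendsto {k : ℕ} {α : Type*} {l : Filter α} [l.NeBot]
    {F : α → (ι → ℝ) → ℝ} {f : (ι → ℝ) → ℝ} (hF : ∀ᶠ a in l, DiffNonneg k (F a))
    (hlim : ∀ x ∈ posOrthant ι, Tendsto (fun a => F a x) l (𝓝 (f x))) : DiffNonneg k f := by
  induction k generalizing F f with
  | zero => exact fun x hx => ge_of_tendsto (hlim x hx) (hF.mono fun a ha => ha x hx)
  | succ k ih =>
    intro i h hh
    exact ih (F := fun a => backDiff h i (F a)) (hF.mono fun a ha => ha i h hh)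
      fun x hx => (hlim x hx).sub (hlim _ (add_single_mem_posOrthant hx i hh.le))

theorem DiffNonneg.integral {k : ℕ} {α : Type*} [MeasurableSpace α] {μ : Measure α}
    {F : α → (ι → ℝ) → ℝ} (hF : ∀ᵐ a ∂μ, DiffNonneg k (F a))
    (hint : ∀ x ∈ posOrthant ι, Integrable (fun a => F a x) μ) :
    DiffNonneg k (fun x => ∫ a, F a x ∂μ) := by
  induction k generalizing F with
  | zero => exact fun x hx => integral_nonneg_of_ae (hF.mono fun a ha => ha x hx)
  | succ k ih =>
    intro i h hh
    refine (ih (F := fun a => backDiff h i (F a)) (hF.mono fun a ha => ha i h hh)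
      fun x hx => (hint x hx).sub (hint _ (add_single_mem_posOrthant hx i hh.le))).congr
      fun x hx => ?_
    exact integral_sub (hint x hx) (hint _ (add_single_mem_posOrthant hx i hh.le))

theorem DiffMonotone.congr {f g : (ι → ℝ) → ℝ} (hf : DiffMonotone f)
    (hfg : ∀ x ∈ posOrthant ι, f x = g x) : DiffMonotone g := fun k => (hf k).congr hfg

theorem DiffMonotone.add {f g : (ι → ℝ) → ℝ} (hf : DiffMonotone f) (hg : DiffMonotone g) :
    DiffMonotone (f + g) := fun k => (hf k).add (hg k)

theorem DiffMonotone.smul {f : (ι → ℝ) → ℝ} (hf : DiffMonotone f) {c : ℝ} (hc : 0 ≤ c) :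
    DiffMonotone (c • f) := fun k => (hf k).smul hc

theorem DiffMonotone.integral {α : Type*} [MeasurableSpace α] {μ : Measure α}
    {F : α → (ι → ℝ) → ℝ} (hF : ∀ᵐ a ∂μ, DiffMonotone (F a))
    (hint : ∀ x ∈ posOrthant ι, Integrable (fun a => F a x) μ) :
    DiffMonotone (fun x => ∫ a, F a x ∂μ) :=
  fun k => DiffNonneg.integral (hF.mono fun _ ha => ha k) hint

theorem DiffMonotone.backDiff {f : (ι → ℝ) → ℝ} (hf : DiffMonotone f) {h : ℝ} (hh : 0 < h)
    (i : ι) : DiffMonotone (backDiff h i f) := fun k => hf (k + 1) i h hh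

theorem DiffMonotone.nonneg {f : (ι → ℝ) → ℝ} (hf : DiffMonotone f) {x : ι → ℝ}
    (hx : x ∈ posOrthant ι) : 0 ≤ f x := hf 0 x hx

theorem DiffNonneg.shiftOp {k : ℕ} {f : (ι → ℝ) → ℝ} (hf : DiffNonneg k f) {h : ℝ}
    (hh : 0 < h) (i : ι) : DiffNonneg k (shiftOp h i f) := by
  induction k generalizing f with
  | zero => exact fun x hx => hf _ (add_single_mem_posOrthant hx i hh.le)
  | succ k ih =>
    intro j h' hh'
    refine (ih (hf j h' hh')).congr fun x _ => ?_
    change f _ - f _ = f _ - f _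
    rw [add_right_comm]

theorem DiffMonotone.shiftOp {f : (ι → ℝ) → ℝ} (hf : DiffMonotone f) {h : ℝ}
    (hh : 0 < h) (i : ι) : DiffMonotone (shiftOp h i f) := fun k => (hf k).shiftOp hh i

theorem DiffMonotone.mul {f g : (ι → ℝ) → ℝ} (hf : DiffMonotone f) (hg : DiffMonotone g) :
    DiffMonotone (f * g) := by
  intro k
  induction k generalizing f g with
  | zero => exact fun x hx => mul_nonneg (hf.nonneg hx) (hg.nonneg hx)
  | succ k ih =>
    intro i h hh
    refine ((ih (hf.backDiff hh i) hg).add (ih (hf.shiftOp hh i) (hg.backDiff hh i))).congr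
      fun x _ => ?_
    change (f x - f _) * g x + f _ * (g x - g _) = f x * g x - f _ * g _
    ring

theorem diffMonotone_exp_neg_sum [Fintype ι] {a : ι → ℝ} (ha : ∀ i, 0 ≤ a i) :
    DiffMonotone (fun x : ι → ℝ => Real.exp (-∑ i, x i * a i)) := by
  intro k
  induction k with
  | zero => exact fun x _ => (Real.exp_pos _).le
  | succ k ih =>
    intro i h hh
    have hc : 0 ≤ 1 - Real.exp (-(h * a i)) :=
      sub_nonneg.2 (Real.exp_le_one_iff.2 (neg_nonpos.2 (mul_nonneg hh.le (ha i))))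
    refine (ih.smul hc).congr fun x _ => ?_
    change (1 - Real.exp (-(h * a i))) * Real.exp (-∑ i, x i * a i) =
      Real.exp (-∑ i, x i * a i) - Real.exp (-∑ j, (x + Pi.single i h : ι → ℝ) j * a j)
    have : ∑ j, (x + Pi.single i h : ι → ℝ) j * a j = ∑ j, x j * a j + h * a i := by
      simp [add_mul, Finset.sum_add_distrib, Pi.single_apply]
    rw [this, neg_add, Real.exp_add]
    ring

theorem diffMonotone_const {c : ℝ} (hc : 0 ≤ c) : DiffMonotone (fun _ : ι → ℝ => c) := by
  intro k
  induction k generalizing c with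
  | zero => exact fun _ _ => hc
  | succ k ih =>
    intro i h hh
    exact (ih le_rfl).congr fun x _ => (sub_self c).symm

/-- A linear operator preserving difference monotonicity. -/
def PreservesDiffMonotone (A : Module.End ℝ ((ι → ℝ) → ℝ)) : Prop :=
  ∀ f, DiffMonotone f → DiffMonotone (A f)

theorem PreservesDiffMonotone.mul {A B : Module.End ℝ ((ι → ℝ) → ℝ)}
    (hA : PreservesDiffMonotone A) (hB : PreservesDiffMonotone B) :
    PreservesDiffMonotone (A * B) := fun f hf => hA _ (hB f hf)

theorem PreservesDiffMonotone.add {A B : Module.End ℝ ((ι → ℝ) → ℝ)}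
    (hA : PreservesDiffMonotone A) (hB : PreservesDiffMonotone B) :
    PreservesDiffMonotone (A + B) := fun f hf => (hA f hf).add (hB f hf)

theorem PreservesDiffMonotone.smul {A : Module.End ℝ ((ι → ℝ) → ℝ)}
    (hA : PreservesDiffMonotone A) {c : ℝ} (hc : 0 ≤ c) :
    PreservesDiffMonotone (c • A) := fun f hf => (hA f hf).smul hc

theorem PreservesDiffMonotone.pow {A : Module.End ℝ ((ι → ℝ) → ℝ)}
    (hA : PreservesDiffMonotone A) (k : ℕ) : PreservesDiffMonotone (A ^ k) := by
  induction k with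
  | zero => exact fun f hf => hf
  | succ k ih => rw [pow_succ]; exact ih.mul hA

theorem PreservesDiffMonotone.sum {α : Type*} {s : Finset α}
    {A : α → Module.End ℝ ((ι → ℝ) → ℝ)} (hA : ∀ a ∈ s, PreservesDiffMonotone (A a)) :
    PreservesDiffMonotone (∑ a ∈ s, A a) := by
  classical
  induction s using Finset.induction_on with
  | empty =>
    rw [Finset.sum_empty]
    exact fun f _ => diffMonotone_const le_rfl
  | insert a s ha ih =>
    rw [Finset.sum_insert ha]
    exact (hA a (Finset.mem_insert_self a s)).add
      (ih fun b hb => hA b (Finset.mem_insert_of_mem hb))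

theorem sum_sq_smul_bernsteinPolynomial (N : ℕ) :
    ∑ ν ∈ Finset.range (N + 1), ((2 * ν - N : ℝ) ^ 2) • bernsteinPolynomial ℝ N ν =
      ((N : ℝ) ^ 2) • (2 * Polynomial.X - 1) ^ 2 + (4 * N : ℝ) • (Polynomial.X * (1 - Polynomial.X)) := by
  have h0 := bernsteinPolynomial.sum ℝ N
  have h1 := bernsteinPolynomial.sum_smul ℝ N
  have h2 := bernsteinPolynomial.variance ℝ N
  have key : ∀ ν : ℕ, ((2 * ν - N : ℝ) ^ 2) • bernsteinPolynomial ℝ N ν =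
      4 * ((N • Polynomial.X - (ν : ℝ[X])) ^ 2 * bernsteinPolynomial ℝ N ν)
      + (4 * (N : ℝ[X]) * (2 * Polynomial.X - 1)) * (ν • bernsteinPolynomial ℝ N ν)
      + ((N : ℝ[X]) ^ 2 - 4 * (N : ℝ[X]) ^ 2 * Polynomial.X ^ 2) * bernsteinPolynomial ℝ N ν := by
    intro ν
    simp only [Polynomial.smul_eq_C_mul, nsmul_eq_mul, map_pow, map_sub, map_mul, map_natCast,
      map_ofNat]
    ring
  rw [Finset.sum_congr rfl fun ν _ => key ν, Finset.sum_add_distrib, Finset.sum_add_distrib,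
    ← Finset.mul_sum, ← Finset.mul_sum, ← Finset.mul_sum, h0, h1, h2]
  simp only [Polynomial.smul_eq_C_mul, nsmul_eq_mul, map_pow, map_mul, map_natCast,
      map_ofNat]
  ring

/-- Positivity of squares: if `U` and `1 - U` preserve difference monotonicity, then so does
`(2U - 1)²`. -/
theorem PreservesDiffMonotone.sq {U : Module.End ℝ ((ι → ℝ) → ℝ)}
    (hU : PreservesDiffMonotone U) (hU' : PreservesDiffMonotone (1 - U)) :
    PreservesDiffMonotone ((2 * U - 1) ^ 2) := by
  intro f hf k
  have hpos : ∀ N : ℕ, PreservesDiffMonotone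
      (((N : ℝ) ^ 2) • (2 * U - 1) ^ 2 + (4 * N : ℝ) • (U * (1 - U))) := by
    intro N
    have h := congrArg (Polynomial.aeval U) (sum_sq_smul_bernsteinPolynomial N)
    simp only [map_sum, map_add, map_smul, map_pow, map_sub, map_mul, map_one, Polynomial.aeval_X,
      map_ofNat] at h
    rw [← h]
    refine PreservesDiffMonotone.sum fun ν _ => PreservesDiffMonotone.smul ?_ (sq_nonneg _)
    have hb : Polynomial.aeval U (bernsteinPolynomial ℝ N ν) =
        (N.choose ν : ℝ) • (U ^ ν * (1 - U) ^ (N - ν)) := by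
      simp [bernsteinPolynomial, mul_assoc, Algebra.smul_def]
    rw [hb]
    exact ((hU.pow ν).mul (hU'.pow _)).smul (Nat.cast_nonneg _)
  generalize (2 * U - 1) ^ 2 = W at hpos ⊢
  refine DiffNonneg.of_tendsto (l := atTop)
    (F := fun N : ℕ => W f + (4 * (N : ℝ)⁻¹) • (U * (1 - U)) f) ?_ ?_
  · filter_upwards [eventually_gt_atTop 0] with N hN
    have hN' : (N : ℝ) ≠ 0 := by positivity
    refine (((hpos N f hf).smul (c := ((N : ℝ) ^ 2)⁻¹) (by positivity)) k).congr fun x _ => ?_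
    simp only [LinearMap.add_apply, LinearMap.smul_apply, Pi.smul_apply, Pi.add_apply,
      smul_eq_mul]
    field_simp
  · intro x _
    have : Tendsto (fun N : ℕ => W f x + (4 * (N : ℝ)⁻¹) * (U * (1 - U)) f x)
        atTop (𝓝 (W f x + (4 * 0) * (U * (1 - U)) f x)) :=
      ((tendsto_inv_atTop_nhds_zero_nat.const_mul 4).mul_const _).const_add _
    simpa using this

/-- The second-order difference operator with coefficient matrix `B`. -/
noncomputable def quadDiff [Fintype ι] (B : ι → ι → ℝ) (h : ℝ) : Module.End ℝ ((ι → ℝ) → ℝ) :=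
  ∑ p : ι × ι, B p.1 p.2 • (backDiff h p.1 * backDiff h p.2)

theorem preservesDiffMonotone_quadDiff_sq [Fintype ι] (B : ι → ι → ℝ) {h : ℝ} (hh : 0 < h) :
    PreservesDiffMonotone (quadDiff B h ^ 2) := by
  have hD : ∀ i : ι, PreservesDiffMonotone (backDiff h i) := fun i f hf => hf.backDiff hh i
  have hS : ∀ i : ι, PreservesDiffMonotone (shiftOp h i) := fun i f hf => hf.shiftOp hh i
  have hDD : ∀ i j : ι, PreservesDiffMonotone (1 - backDiff h i * backDiff h j) := by
    intro i j
    have : 1 - backDiff h i * backDiff h j = shiftOp h i + backDiff h i * shiftOp h j := by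
      ext f x
      simp only [backDiff, shiftOp, LinearMap.sub_apply, LinearMap.add_apply, Module.End.mul_apply,
        Module.End.one_apply, LinearMap.coe_mk, AddHom.coe_mk, Pi.sub_apply, Pi.add_apply]
      ring
    rw [this]
    exact (hS i).add ((hD i).mul (hS j))
  set q := quadDiff B h with hq
  set c : ℝ := ∑ p : ι × ι, |B p.1 p.2| + 1 with hc
  have hcpos : 0 < c := by positivity
  have hbound : ∀ C : ι → ι → ℝ, (∀ i j, |C i j| = |B i j|) →
      PreservesDiffMonotone (c • (1 : Module.End ℝ ((ι → ℝ) → ℝ)) +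
        ∑ p : ι × ι, C p.1 p.2 • (backDiff h p.1 * backDiff h p.2)) := by
    intro C hC
    have h1 : c • (1 : Module.End ℝ ((ι → ℝ) → ℝ)) +
        ∑ p : ι × ι, C p.1 p.2 • (backDiff h p.1 * backDiff h p.2) =
        ∑ p : ι × ι, (|C p.1 p.2| • (1 : Module.End ℝ ((ι → ℝ) → ℝ)) +
          C p.1 p.2 • (backDiff h p.1 * backDiff h p.2)) + (1 : Module.End ℝ _) := by
      simp only [Finset.sum_add_distrib, ← Finset.sum_smul, hC, hc, add_smul, one_smul]
      abel
    rw [h1]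
    refine (PreservesDiffMonotone.sum fun p _ => ?_).add fun f hf => hf
    rcases le_total 0 (C p.1 p.2) with h0 | h0
    · exact (PreservesDiffMonotone.smul (fun f hf => hf) (abs_nonneg _)).add
        (((hD _).mul (hD _)).smul h0)
    · have h2 : |C p.1 p.2| • (1 : Module.End ℝ ((ι → ℝ) → ℝ)) +
          C p.1 p.2 • (backDiff h p.1 * backDiff h p.2) =
          |C p.1 p.2| • (1 - backDiff h p.1 * backDiff h p.2) := by
        rw [abs_of_nonpos h0]
        ext f x
        simp only [LinearMap.sub_apply, LinearMap.add_apply, LinearMap.smul_apply,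
          Module.End.one_apply, Pi.sub_apply, Pi.add_apply, Pi.smul_apply, smul_eq_mul]
        ring
      rw [h2]
      exact (hDD _ _).smul (abs_nonneg _)
  have hplus : PreservesDiffMonotone (c • (1 : Module.End ℝ ((ι → ℝ) → ℝ)) + q) :=
    hbound B fun _ _ => rfl
  have hminus : PreservesDiffMonotone (c • (1 : Module.End ℝ ((ι → ℝ) → ℝ)) - q) := by
    have := hbound (fun i j => -B i j) fun _ _ => abs_neg _
    convert this using 1
    ext f x
    simp [hq, quadDiff, sub_eq_add_neg]
  set U : Module.End ℝ ((ι → ℝ) → ℝ) := (2 * c)⁻¹ • (c • 1 + q) with hUdef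
  have hU' : 1 - U = (2 * c)⁻¹ • (c • (1 : Module.End ℝ ((ι → ℝ) → ℝ)) - q) := by
    ext f x
    simp only [hUdef, LinearMap.sub_apply, LinearMap.smul_apply, LinearMap.add_apply,
      Pi.sub_apply, Pi.smul_apply, Pi.add_apply, smul_eq_mul, Module.End.one_apply]
    field_simp
    ring
  have hqU : q = c • (2 * U - 1) := by
    ext f x
    simp only [hUdef, LinearMap.sub_apply, LinearMap.smul_apply, LinearMap.add_apply,
      Pi.sub_apply, Pi.smul_apply, Pi.add_apply, smul_eq_mul, Module.End.one_apply, two_mul]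
    field_simp
    ring
  rw [hqU, smul_pow]
  refine PreservesDiffMonotone.smul (PreservesDiffMonotone.sq ?_ ?_) (sq_nonneg c)
  · exact hplus.smul (by positivity)
  · rw [hU']; exact hminus.smul (by positivity)

end DifferenceMonotone

section PartialDerivatives

variable {ι : Type*} [Fintype ι] [DecidableEq ι]

/-- The partial derivative in the `i`-th coordinate. -/
noncomputable def partialDeriv (i : ι) (f : (ι → ℝ) → ℝ) : (ι → ℝ) → ℝ :=
  fun x => fderiv ℝ f x (Pi.single i 1)

/-- Iterated partial derivatives along a list of coordinates (the head is applied last). -/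
noncomputable def iterPartialDeriv : List ι → ((ι → ℝ) → ℝ) → (ι → ℝ) → ℝ
  | [], f => f
  | i :: l, f => partialDeriv i (iterPartialDeriv l f)

/-- Iterated backward differences along a list of coordinates (the head is applied first). -/
noncomputable def iterBackDiff (h : ℝ) : List ι → ((ι → ℝ) → ℝ) → (ι → ℝ) → ℝ
  | [], f => f
  | i :: l, f => iterBackDiff h l (backDiff h i f)

omit [DecidableEq ι] in
theorem isOpen_posOrthant : IsOpen (posOrthant ι) := by
  have : posOrthant ι = Set.univ.pi fun _ => Set.Ioi 0 := by
    ext x; simp [posOrthant]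
  rw [this]
  exact isOpen_set_pi Set.finite_univ fun _ _ => isOpen_Ioi

/-- Smoothness on the open orthant. -/
def SmoothOnOrthant (f : (ι → ℝ) → ℝ) : Prop := ContDiffOn ℝ (⊤ : ℕ∞) f (posOrthant ι)

omit [DecidableEq ι] in
theorem SmoothOnOrthant.differentiableAt {f : (ι → ℝ) → ℝ} (hf : SmoothOnOrthant f) {x : ι → ℝ}
    (hx : x ∈ posOrthant ι) : DifferentiableAt ℝ f x :=
  (ContDiffOn.contDiffAt hf (isOpen_posOrthant.mem_nhds hx)).differentiableAt (by simp)

theorem SmoothOnOrthant.partialDeriv {f : (ι → ℝ) → ℝ} (hf : SmoothOnOrthant f) (i : ι) :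
    SmoothOnOrthant (partialDeriv i f) :=
  (ContDiffOn.fderiv_of_isOpen hf isOpen_posOrthant (by simp)).clm_apply contDiffOn_const

theorem SmoothOnOrthant.iterPartialDeriv {f : (ι → ℝ) → ℝ} (hf : SmoothOnOrthant f)
    (l : List ι) : SmoothOnOrthant (iterPartialDeriv l f) := by
  induction l with
  | nil => exact hf
  | cons i l ih => exact ih.partialDeriv i

theorem SmoothOnOrthant.backDiff {f : (ι → ℝ) → ℝ} (hf : SmoothOnOrthant f) {h : ℝ}
    (hh : 0 ≤ h) (i : ι) : SmoothOnOrthant (backDiff h i f) := by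
  refine ContDiffOn.sub hf (ContDiffOn.comp hf (t := posOrthant ι) ?_ fun x hx =>
    add_single_mem_posOrthant hx i hh)
  fun_prop

theorem partialDeriv_congr {f g : (ι → ℝ) → ℝ} (hfg : ∀ x ∈ posOrthant ι, f x = g x) (i : ι)
    {x : ι → ℝ} (hx : x ∈ posOrthant ι) : partialDeriv i f x = partialDeriv i g x := by
  have : f =ᶠ[𝓝 x] g := by
    filter_upwards [isOpen_posOrthant.mem_nhds hx] with y hy using hfg y hy
  simp only [partialDeriv, this.fderiv_eq]

theorem iterPartialDeriv_congr {f g : (ι → ℝ) → ℝ} (hfg : ∀ x ∈ posOrthant ι, f x = g x)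
    (l : List ι) {x : ι → ℝ} (hx : x ∈ posOrthant ι) :
    iterPartialDeriv l f x = iterPartialDeriv l g x := by
  induction l generalizing x with
  | nil => exact hfg x hx
  | cons i l ih => exact partialDeriv_congr (fun y hy => ih hy) i hx

theorem iterPartialDeriv_sum {α : Type*} (s : Finset α) (a : α → ℝ) (g : α → (ι → ℝ) → ℝ)
    (hg : ∀ p, SmoothOnOrthant (g p)) (l : List ι) {x : ι → ℝ} (hx : x ∈ posOrthant ι) :
    iterPartialDeriv l (fun y => ∑ p ∈ s, a p * g p y) x =
      ∑ p ∈ s, a p * iterPartialDeriv l (g p) x := by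
  induction l generalizing x with
  | nil => rfl
  | cons i l ih =>
    have h1 := partialDeriv_congr (fun y hy => ih hy) i hx
    change partialDeriv i _ x = _
    rw [h1]
    have hd : ∀ p, DifferentiableAt ℝ (iterPartialDeriv l (g p)) x :=
      fun p => ((hg p).iterPartialDeriv l).differentiableAt hx
    simp only [partialDeriv, iterPartialDeriv]
    rw [fderiv_fun_sum fun p _ => (hd p).const_mul (a p)]
    simp only [fderiv_const_mul (hd _), sum_apply,
      smul_apply, smul_eq_mul]

theorem hasDerivAt_add_single {f : (ι → ℝ) → ℝ} {x : ι → ℝ} {i : ι} {t : ℝ}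
    (hf : DifferentiableAt ℝ f (x + Pi.single i t)) :
    HasDerivAt (fun s : ℝ => f (x + Pi.single i s)) (partialDeriv i f (x + Pi.single i t)) t := by
  have h1 : HasDerivAt (fun s : ℝ => x + Pi.single i s) (Pi.single i (1 : ℝ)) t :=
    (hasDerivAt_single i t).const_add x
  exact hf.hasFDerivAt.comp_hasDerivAt t h1

theorem partialDeriv_backDiff {f : (ι → ℝ) → ℝ} (hf : SmoothOnOrthant f) {h : ℝ} (hh : 0 ≤ h)
    (i j : ι) {x : ι → ℝ} (hx : x ∈ posOrthant ι) :
    partialDeriv j (backDiff h i f) x = backDiff h i (partialDeriv j f) x := by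
  have hx' := add_single_mem_posOrthant hx i hh
  have h1 : DifferentiableAt ℝ (fun y => f (y + Pi.single i h)) x :=
    (differentiableAt_comp_add_right (Pi.single i h)).2 (hf.differentiableAt hx')
  change fderiv ℝ (fun y => f y - f (y + Pi.single i h)) x (Pi.single j 1) =
    fderiv ℝ f x _ - fderiv ℝ f (x + Pi.single i h) _
  rw [fderiv_fun_sub (hf.differentiableAt hx) h1, fderiv_comp_add_right]
  rfl

theorem iterPartialDeriv_backDiff {f : (ι → ℝ) → ℝ} (hf : SmoothOnOrthant f) {h : ℝ}
    (hh : 0 ≤ h) (i : ι) (l : List ι) {x : ι → ℝ} (hx : x ∈ posOrthant ι) :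
    iterPartialDeriv l (backDiff h i f) x = backDiff h i (iterPartialDeriv l f) x := by
  induction l generalizing x with
  | nil => rfl
  | cons j l ih =>
    change partialDeriv j _ x = _
    rw [partialDeriv_congr (fun y hy => ih hy) j hx,
      partialDeriv_backDiff (hf.iterPartialDeriv l) hh i j hx]
    rfl

/-- Mean value theorem for a single backward difference. -/
theorem exists_backDiff_eq {f : (ι → ℝ) → ℝ} (hf : SmoothOnOrthant f) {h : ℝ} (hh : 0 < h)
    (i : ι) {x : ι → ℝ} (hx : x ∈ posOrthant ι) :
    ∃ t, 0 < t ∧ t < h ∧ backDiff h i f x = -h * partialDeriv i f (x + Pi.single i t) := by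
  have hd : ∀ t, 0 ≤ t → HasDerivAt (fun s : ℝ => f (x + Pi.single i s))
      (partialDeriv i f (x + Pi.single i t)) t := fun t ht =>
    hasDerivAt_add_single (hf.differentiableAt (add_single_mem_posOrthant hx i ht))
  obtain ⟨t, ht, hslope⟩ := exists_hasDerivAt_eq_slope (fun s : ℝ => f (x + Pi.single i s)) _ hh
    (fun t ht => (hd t ht.1).continuousAt.continuousWithinAt) (fun t ht => hd t ht.1.le)
  refine ⟨t, ht.1, ht.2, ?_⟩
  rw [hslope]
  simp only [Pi.single_zero, add_zero, sub_zero]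
  change f x - f (x + Pi.single i h) = _
  field_simp
  ring

/-- Mean value theorem for iterated backward differences. -/
theorem exists_iterBackDiff_eq {f : (ι → ℝ) → ℝ} (hf : SmoothOnOrthant f) {h : ℝ} (hh : 0 < h)
    (l : List ι) {x : ι → ℝ} (hx : x ∈ posOrthant ι) :
    ∃ ξ : ι → ℝ, (∀ j, x j ≤ ξ j ∧ ξ j ≤ x j + l.length * h) ∧
      iterBackDiff h l f x = (-h) ^ l.length * iterPartialDeriv l f ξ := by
  induction l generalizing f with
  | nil => exact ⟨x, by simp, by simp [iterBackDiff, iterPartialDeriv]⟩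
  | cons i l ih =>
    obtain ⟨ξ, hξ, heq⟩ := ih (hf.backDiff hh.le i)
    have hξO : ξ ∈ posOrthant ι := fun j => (hx j).trans_le (hξ j).1
    obtain ⟨t, ht0, hth, ht⟩ := exists_backDiff_eq (hf.iterPartialDeriv l) hh i hξO
    refine ⟨ξ + Pi.single i t, fun j => ?_, ?_⟩
    · have h1 := hξ j
      by_cases hj : j = i
      · subst hj
        simp only [Pi.add_apply, Pi.single_eq_same, List.length_cons, Nat.cast_add, Nat.cast_one]
        constructor <;> nlinarith
      · simp only [Pi.add_apply, Pi.single_eq_of_ne hj, List.length_cons, Nat.cast_add,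
          Nat.cast_one]
        constructor <;> nlinarith
    · change iterBackDiff h l (backDiff h i f) x = _
      rw [heq, iterPartialDeriv_backDiff hf hh.le i l hξO, ht, List.length_cons, pow_succ,
        mul_assoc]
      rfl

theorem tendsto_iterBackDiff {f : (ι → ℝ) → ℝ} (hf : SmoothOnOrthant f) (l : List ι)
    {x : ι → ℝ} (hx : x ∈ posOrthant ι) :
    Tendsto (fun h : ℝ => iterBackDiff h l f x / (-h) ^ l.length) (𝓝[>] 0)
      (𝓝 (iterPartialDeriv l f x)) := by
  have hex : ∀ h : ℝ, ∃ ξ : ι → ℝ, 0 < h → (∀ j, x j ≤ ξ j ∧ ξ j ≤ x j + l.length * h) ∧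
      iterBackDiff h l f x = (-h) ^ l.length * iterPartialDeriv l f ξ := by
    intro h
    by_cases hh : 0 < h
    · obtain ⟨ξ, h1⟩ := exists_iterBackDiff_eq hf hh l hx
      exact ⟨ξ, fun _ => h1⟩
    · exact ⟨x, fun h' => absurd h' hh⟩
  choose ξ hξ using hex
  have hlim : Tendsto ξ (𝓝[>] 0) (𝓝 x) := by
    rw [tendsto_pi_nhds]
    intro j
    refine tendsto_of_tendsto_of_tendsto_of_le_of_le' (g := fun _ => x j)
      (h := fun h : ℝ => x j + l.length * h) tendsto_const_nhds ?_ ?_ ?_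
    · have : Tendsto (fun h : ℝ => x j + l.length * h) (𝓝 0) (𝓝 (x j + l.length * 0)) :=
        (continuous_const.add (continuous_const.mul continuous_id)).tendsto 0
      rw [mul_zero, add_zero] at this
      exact this.mono_left nhdsWithin_le_nhds
    · filter_upwards [self_mem_nhdsWithin] with h hh using ((hξ h hh).1 j).1
    · filter_upwards [self_mem_nhdsWithin] with h hh using ((hξ h hh).1 j).2
  have hc : ContinuousAt (iterPartialDeriv l f) x :=
    ((hf.iterPartialDeriv l).differentiableAt hx).continuousAt
  refine (hc.tendsto.comp hlim).congr' ?_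
  filter_upwards [self_mem_nhdsWithin] with h hh
  have hne : (-h) ^ l.length ≠ 0 := pow_ne_zero _ (neg_ne_zero.2 (ne_of_gt hh))
  rw [(hξ h hh).2, Function.comp, mul_div_cancel_left₀ _ hne]

theorem iteratedFDerivWithin_eq_iterPartialDeriv {f : (ι → ℝ) → ℝ} (hf : SmoothOnOrthant f)
    (k : ℕ) (idx : Fin k → ι) {x : ι → ℝ} (hx : x ∈ posOrthant ι) :
    iteratedFDerivWithin ℝ k f (posOrthant ι) x (fun j => Pi.single (idx j) (1 : ℝ)) =
      iterPartialDeriv (List.ofFn idx) f x := by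
  induction k generalizing x with
  | zero => simp [iterPartialDeriv]
  | succ k ih =>
    rw [iteratedFDerivWithin_succ_apply_left, List.ofFn_succ]
    have hd : DifferentiableWithinAt ℝ (iteratedFDerivWithin ℝ k f (posOrthant ι))
        (posOrthant ι) x :=
      ContDiffOn.differentiableOn_iteratedFDerivWithin hf
        (by exact_mod_cast WithTop.coe_lt_top _) isOpen_posOrthant.uniqueDiffOn x hx
    have hc := partialDeriv_congr (fun y hy => (ih (fun j => idx j.succ) hy).symm) (idx 0) hx
    change _ = partialDeriv (idx 0) _ x
    rw [hc, partialDeriv, fderivWithin_of_isOpen isOpen_posOrthant hx]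
    have hd' := hd.differentiableAt (isOpen_posOrthant.mem_nhds hx)
    rw [fderiv_continuousMultilinear_apply_const hd']
    rfl

theorem completelyMonotoneOnOrthant_iff {f : (ι → ℝ) → ℝ} :
    CompletelyMonotoneOnOrthant f ↔ SmoothOnOrthant f ∧
      ∀ (l : List ι), ∀ x ∈ posOrthant ι, 0 ≤ (-1 : ℝ) ^ l.length * iterPartialDeriv l f x := by
  refine and_congr_right fun hf => ⟨fun H l x hx => ?_, fun H k idx x hx => ?_⟩
  · have := H l.length l.get x hx
    rwa [iteratedFDerivWithin_eq_iterPartialDeriv hf _ _ hx, List.ofFn_get] at this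
  · have := H (List.ofFn idx) x hx
    rwa [iteratedFDerivWithin_eq_iterPartialDeriv hf _ _ hx,
      ← congrArg (fun j => (-1 : ℝ) ^ j) (List.length_ofFn (f := idx))]

theorem DiffMonotone.neg_partialDeriv {f : (ι → ℝ) → ℝ} (hf : DiffMonotone f)
    (hs : SmoothOnOrthant f) (i : ι) : DiffMonotone (fun x => -partialDeriv i f x) := by
  intro k
  refine DiffNonneg.of_tendsto (l := 𝓝[>] (0 : ℝ)) (F := fun h => h⁻¹ • _root_.backDiff h i f) ?_ ?_
  · filter_upwards [self_mem_nhdsWithin] with h hh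
    exact ((hf.backDiff hh i).smul (inv_nonneg.2 (le_of_lt hh))) k
  · intro x hx
    refine (tendsto_iterBackDiff hs [i] hx).neg.congr fun h => ?_
    simp [iterBackDiff, div_eq_inv_mul]

/-- A smooth difference monotone function is completely monotone. -/
theorem DiffMonotone.completelyMonotoneOnOrthant {f : (ι → ℝ) → ℝ} (hf : DiffMonotone f)
    (hs : SmoothOnOrthant f) : CompletelyMonotoneOnOrthant f := by
  refine completelyMonotoneOnOrthant_iff.2 ⟨hs, fun l => ?_⟩
  suffices h : DiffMonotone (fun x => (-1 : ℝ) ^ l.length * _root_.iterPartialDeriv l f x) from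
    fun x hx => h.nonneg hx
  induction l with
  | nil => simpa [iterPartialDeriv] using hf
  | cons i l ih =>
    have hs' : SmoothOnOrthant (fun x => (-1 : ℝ) ^ l.length * _root_.iterPartialDeriv l f x) :=
      contDiffOn_const.mul (hs.iterPartialDeriv l)
    refine (ih.neg_partialDeriv hs' i).congr fun x hx => ?_
    have hd := (hs.iterPartialDeriv l).differentiableAt hx
    simp only [partialDeriv, iterPartialDeriv, List.length_cons]
    rw [fderiv_const_mul hd, smul_apply, smul_eq_mul]
    ring

/-- A completely monotone function is difference monotone. -/
theorem CompletelyMonotoneOnOrthant.diffMonotone {f : (ι → ℝ) → ℝ}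
    (hf : CompletelyMonotoneOnOrthant f) : DiffMonotone f := by
  obtain ⟨hs, hp⟩ := completelyMonotoneOnOrthant_iff.1 hf
  clear hf
  intro k
  induction k generalizing f with
  | zero => exact fun x hx => by simpa [iterPartialDeriv] using hp [] x hx
  | succ k ih =>
    intro i h hh
    refine ih (hs.backDiff hh.le i) fun l x hx => ?_
    rw [iterPartialDeriv_backDiff hs hh.le i l hx]
    obtain ⟨t, ht, -, heq⟩ := exists_backDiff_eq (hs.iterPartialDeriv l) hh i hx
    have h1 := hp (i :: l) _ (add_single_mem_posOrthant hx i ht.le)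
    rw [heq]
    have h2 := mul_nonneg hh.le h1
    rw [List.length_cons, pow_succ] at h2
    change 0 ≤ h * ((-1) ^ l.length * (-1) * partialDeriv i (iterPartialDeriv l f) _) at h2
    linarith

/-- The fourth-order operator obtained by squaring a constant-coefficient second-order
operator is nonnegative on smooth difference monotone functions. -/
theorem DiffMonotone.sum_iterPartialDeriv_nonneg {f : (ι → ℝ) → ℝ} (hf : DiffMonotone f)
    (hs : SmoothOnOrthant f) (B : ι → ι → ℝ) {x : ι → ℝ} (hx : x ∈ posOrthant ι) :
    0 ≤ ∑ p : ι × ι, ∑ q : ι × ι, B p.1 p.2 * (B q.1 q.2 *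
      _root_.iterPartialDeriv [q.2, q.1, p.2, p.1] f x) := by
  have hlim : Tendsto (fun h : ℝ => ∑ p : ι × ι, ∑ q : ι × ι, B p.1 p.2 * (B q.1 q.2 *
      (iterBackDiff h [q.2, q.1, p.2, p.1] f x / (-h) ^ 4))) (𝓝[>] 0)
      (𝓝 (∑ p : ι × ι, ∑ q : ι × ι, B p.1 p.2 * (B q.1 q.2 *
        _root_.iterPartialDeriv [q.2, q.1, p.2, p.1] f x))) :=
    tendsto_finsetSum _ fun p _ => tendsto_finsetSum _ fun q _ =>
      ((tendsto_iterBackDiff hs [q.2, q.1, p.2, p.1] hx).const_mul _).const_mul _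
  refine ge_of_tendsto hlim ?_
  filter_upwards [self_mem_nhdsWithin] with h hh
  have h1 := (preservesDiffMonotone_quadDiff_sq B hh f hf).nonneg hx
  have h2 : (quadDiff B h ^ 2) f x = ∑ p : ι × ι, ∑ q : ι × ι, B p.1 p.2 * (B q.1 q.2 *
      iterBackDiff h [q.2, q.1, p.2, p.1] f x) := by
    have h3 : ∀ g : (ι → ℝ) → ℝ, quadDiff B h g =
        ∑ p : ι × ι, B p.1 p.2 • _root_.backDiff h p.1 (_root_.backDiff h p.2 g) := by
      intro g
      simp [quadDiff, LinearMap.sum_apply]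
    rw [pow_two, Module.End.mul_apply, h3]
    simp only [h3, map_sum, map_smul, Finset.sum_apply, Pi.smul_apply, smul_eq_mul,
      Finset.mul_sum]
    rfl
  have h4 : ∑ p : ι × ι, ∑ q : ι × ι, B p.1 p.2 * (B q.1 q.2 *
      (iterBackDiff h [q.2, q.1, p.2, p.1] f x / (-h) ^ 4)) = (quadDiff B h ^ 2) f x / h ^ 4 := by
    rw [h2, Finset.sum_div]
    refine Finset.sum_congr rfl fun p _ => ?_
    rw [Finset.sum_div]
    refine Finset.sum_congr rfl fun q _ => ?_
    rw [Even.neg_pow (by decide)]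
    ring
  rw [h4]
  exact div_nonneg h1 (by positivity)

end PartialDerivatives

section ElementarySymmetric

theorem E2_eq (n : ℕ) (x : Fin n → ℝ) : E2 n x = ((∑ i, x i) ^ 2 - ∑ i, x i ^ 2) / 2 := by
  have h1 : (∑ i, x i) ^ 2 = ∑ p : Fin n × Fin n, x p.1 * x p.2 := by
    rw [pow_two, Finset.sum_mul_sum, Fintype.sum_prod_type]
  have h2 : ∑ p : Fin n × Fin n, x p.1 * x p.2 =
      ∑ p : Fin n × Fin n, ((if p.1 < p.2 then x p.1 * x p.2 else 0) +
        (if p.2 < p.1 then x p.1 * x p.2 else 0) + (if p.1 = p.2 then x p.1 * x p.2 else 0)) := by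
    refine Finset.sum_congr rfl fun p _ => ?_
    rcases lt_trichotomy p.1 p.2 with h | h | h
    · simp [h, h.not_gt, h.ne]
    · simp [h]
    · simp [h, h.not_gt, h.ne']
  have h3 : ∑ p : Fin n × Fin n, (if p.2 < p.1 then x p.1 * x p.2 else 0) =
      ∑ p : Fin n × Fin n, (if p.1 < p.2 then x p.1 * x p.2 else 0) := by
    rw [← (Equiv.prodComm (Fin n) (Fin n)).sum_comp]
    simp [mul_comm]
  have h4 : ∑ p : Fin n × Fin n, (if p.1 = p.2 then x p.1 * x p.2 else 0) = ∑ i, x i ^ 2 := by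
    simp [Fintype.sum_prod_type, pow_two]
  rw [h1, h2, Finset.sum_add_distrib, Finset.sum_add_distrib, h3, h4, E2, Finset.sum_filter]
  ring

theorem E2_pos {n : ℕ} (hn : 2 ≤ n) {x : Fin n → ℝ} (hx : x ∈ posOrthant (Fin n)) :
    0 < E2 n x := by
  refine Finset.sum_pos (fun p _ => mul_pos (hx _) (hx _)) ⟨(⟨0, by omega⟩, ⟨1, by omega⟩), ?_⟩
  simp

theorem E2_add_single {n : ℕ} (x : Fin n → ℝ) (i : Fin n) (t : ℝ) :
    E2 n (x + Pi.single i t) = E2 n x + t * (∑ j, x j - x i) := by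
  have h1 : ∑ j, (x + Pi.single i t : Fin n → ℝ) j = ∑ j, x j + t := by
    simp [Finset.sum_add_distrib]
  have h2 : ∑ j, (x + Pi.single i t : Fin n → ℝ) j ^ 2 = ∑ j, x j ^ 2 + 2 * t * x i + t ^ 2 := by
    have : ∀ j, (x + Pi.single i t : Fin n → ℝ) j ^ 2 =
        x j ^ 2 + if j = i then 2 * t * x i + t ^ 2 else 0 := by
      intro j
      by_cases hj : j = i
      · subst hj; simp; ring
      · simp [hj]
    rw [Finset.sum_congr rfl fun j _ => this j]
    simp [Finset.sum_add_distrib, add_assoc]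
  rw [E2_eq, E2_eq, h1, h2]
  ring

theorem E2_snoc {n : ℕ} (y : Fin n → ℝ) (t : ℝ) :
    E2 (n + 1) (Fin.snoc y t) = E2 n y + t * ∑ i, y i := by
  rw [E2_eq, E2_eq, Fin.sum_univ_castSucc, Fin.sum_univ_castSucc]
  simp only [Fin.snoc_castSucc, Fin.snoc_last]
  ring

theorem smoothOnOrthant_E2_rpow {n : ℕ} (hn : 2 ≤ n) (s : ℝ) :
    SmoothOnOrthant (fun x : Fin n → ℝ => E2 n x ^ s) := by
  refine ContDiffOn.rpow_const_of_ne ?_ fun x hx => (E2_pos hn hx).ne'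
  unfold E2
  fun_prop

theorem partialDeriv_eq_of_hasDerivAt {ι : Type*} [Fintype ι] [DecidableEq ι]
    {f : (ι → ℝ) → ℝ} (hf : SmoothOnOrthant f) {x : ι → ℝ} (hx : x ∈ posOrthant ι) {i : ι}
    {d : ℝ} (hd : HasDerivAt (fun t : ℝ => f (x + Pi.single i t)) d 0) :
    partialDeriv i f x = d := by
  have h1 := hasDerivAt_add_single (f := f) (x := x) (i := i) (t := 0)
    (by simpa using hf.differentiableAt hx)
  simpa using h1.unique hd

theorem hasDerivAt_E2_rpow {n : ℕ} (hn : 2 ≤ n) (s : ℝ) {x : Fin n → ℝ}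
    (hx : x ∈ posOrthant (Fin n)) (i : Fin n) :
    HasDerivAt (fun t : ℝ => E2 n (x + Pi.single i t) ^ s)
      (s * (∑ j, x j - x i) * E2 n x ^ (s - 1)) 0 := by
  simp only [E2_add_single]
  have h1 : HasDerivAt (fun t : ℝ => E2 n x + t * (∑ j, x j - x i)) (∑ j, x j - x i) 0 := by
    simpa using ((hasDerivAt_id (0 : ℝ)).mul_const (∑ j, x j - x i)).const_add (E2 n x)
  have h2 := h1.rpow_const (p := s) (Or.inl (by simpa using (E2_pos hn hx).ne'))
  simp only [zero_mul, add_zero] at h2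
  convert h2 using 1
  ring

theorem partialDeriv_E2_rpow {n : ℕ} (hn : 2 ≤ n) (s : ℝ) {x : Fin n → ℝ}
    (hx : x ∈ posOrthant (Fin n)) (i : Fin n) :
    partialDeriv i (fun x : Fin n → ℝ => E2 n x ^ s) x =
      s * (∑ j, x j - x i) * E2 n x ^ (s - 1) :=
  partialDeriv_eq_of_hasDerivAt (smoothOnOrthant_E2_rpow hn s) hx (hasDerivAt_E2_rpow hn s hx i)

theorem partialDeriv_partialDeriv_E2_rpow {n : ℕ} (hn : 2 ≤ n) (s : ℝ) {x : Fin n → ℝ}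
    (hx : x ∈ posOrthant (Fin n)) (i j : Fin n) :
    partialDeriv j (partialDeriv i (fun x : Fin n → ℝ => E2 n x ^ s)) x =
      s * (1 - if i = j then 1 else 0) * E2 n x ^ (s - 1) +
      s * (s - 1) * ((∑ k, x k - x i) * (∑ k, x k - x j)) * E2 n x ^ (s - 2) := by
  rw [partialDeriv_congr (g := fun x => s * (∑ k, x k - x i) * E2 n x ^ (s - 1))
    (fun y hy => partialDeriv_E2_rpow hn s hy i) j hx]
  refine partialDeriv_eq_of_hasDerivAt ?_ hx ?_
  · refine ContDiffOn.mul ?_ (smoothOnOrthant_E2_rpow hn (s - 1))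
    fun_prop
  · have h1 : HasDerivAt (fun t : ℝ => s * (∑ k, (x + Pi.single j t : Fin n → ℝ) k -
        (x + Pi.single j t : Fin n → ℝ) i)) (s * (1 - if i = j then 1 else 0)) 0 := by
      have h2 : ∀ t : ℝ, s * (∑ k, (x + Pi.single j t : Fin n → ℝ) k -
          (x + Pi.single j t : Fin n → ℝ) i) =
          s * (∑ k, x k - x i) + t * (s * (1 - if i = j then 1 else 0)) := by
        intro t
        simp only [Pi.add_apply, Finset.sum_add_distrib, Pi.single_apply,
          Finset.sum_ite_eq', Finset.mem_univ, if_true]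
        split_ifs <;> ring
      simp only [h2]
      simpa using ((hasDerivAt_id (0 : ℝ)).mul_const
        (s * (1 - if i = j then 1 else 0))).const_add (s * (∑ k, x k - x i))
    have h3 := h1.mul (hasDerivAt_E2_rpow hn (s - 1) hx j)
    simp only [Pi.single_zero, add_zero] at h3
    refine h3.congr_deriv ?_
    rw [show s - 1 - 1 = s - 2 by ring]
    ring

/-- The inverse of the matrix of the quadratic form `2 E_{2,n}`. -/
noncomputable def dualForm (n : ℕ) (i j : Fin n) : ℝ := 1 / ((n : ℝ) - 1) - if i = j then 1 else 0

/-- The Bernstein–Sato identity for `E_{2,n}`. -/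
theorem sum_dualForm_partialDeriv_E2_rpow {n : ℕ} (hn : 2 ≤ n) (s : ℝ) {x : Fin n → ℝ}
    (hx : x ∈ posOrthant (Fin n)) :
    ∑ p : Fin n × Fin n, dualForm n p.1 p.2 *
      iterPartialDeriv [p.2, p.1] (fun x : Fin n → ℝ => E2 n x ^ s) x =
      s * (n - 2 + 2 * s) * E2 n x ^ (s - 1) := by
  have hn' : (n : ℝ) - 1 ≠ 0 := by
    have : (2 : ℝ) ≤ n := by exact_mod_cast hn
    linarith
  have hE : E2 n x ^ (s - 1) = E2 n x ^ (s - 2) * E2 n x := by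
    rw [← Real.rpow_add_one (E2_pos hn hx).ne']; ring_nf
  set L := ∑ k, x k with hL
  set c := 1 / ((n : ℝ) - 1) with hc
  have key : ∀ p : Fin n × Fin n, dualForm n p.1 p.2 *
      iterPartialDeriv [p.2, p.1] (fun x : Fin n → ℝ => E2 n x ^ s) x =
      c * (s * (s - 1) * E2 n x ^ (s - 2)) * ((L - x p.1) * (L - x p.2)) +
      c * s * E2 n x ^ (s - 1) -
      if p.1 = p.2 then c * s * E2 n x ^ (s - 1) +
        s * (s - 1) * E2 n x ^ (s - 2) * (L - x p.1) ^ 2 else 0 := by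
    intro p
    have := partialDeriv_partialDeriv_E2_rpow hn s hx p.1 p.2
    simp only [iterPartialDeriv, this, dualForm]
    split_ifs with h
    · rw [h]; ring
    · ring
  have hsum : ∑ k, (L - x k) = (n - 1) * L := by
    simp [Finset.sum_sub_distrib, ← hL]; ring
  have hsq : ∑ k, (L - x k) ^ 2 = (n - 2) * L ^ 2 + ∑ k, x k ^ 2 := by
    simp only [sub_sq, Finset.sum_add_distrib, Finset.sum_sub_distrib, ← Finset.mul_sum, ← hL]
    simp; ring
  have hprod : ∑ p : Fin n × Fin n, (L - x p.1) * (L - x p.2) = ((n - 1) * L) ^ 2 := by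
    rw [Fintype.sum_prod_type, ← hsum, pow_two, Finset.sum_mul_sum]
  have hdiag : ∑ p : Fin n × Fin n, (if p.1 = p.2 then c * s * E2 n x ^ (s - 1) +
        s * (s - 1) * E2 n x ^ (s - 2) * (L - x p.1) ^ 2 else 0) =
      n * (c * s * E2 n x ^ (s - 1)) +
        s * (s - 1) * E2 n x ^ (s - 2) * ((n - 2) * L ^ 2 + ∑ k, x k ^ 2) := by
    rw [Fintype.sum_prod_type, ← hsq, Finset.mul_sum]
    simp [Finset.sum_add_distrib]
  have hconst : ∑ _p : Fin n × Fin n, c * s * E2 n x ^ (s - 1) =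
      n ^ 2 * (c * s * E2 n x ^ (s - 1)) := by
    simp [pow_two]
  have hE2 : ∑ k, x k ^ 2 = L ^ 2 - 2 * E2 n x := by rw [E2_eq]; ring
  rw [Finset.sum_congr rfl fun p _ => key p, Finset.sum_sub_distrib, Finset.sum_add_distrib,
    ← Finset.mul_sum, hprod, hdiag, hconst, hE2, hE, hc]
  field_simp
  ring

theorem sum_sum_dualForm_E2_rpow {n : ℕ} (hn : 2 ≤ n) (s : ℝ) {x : Fin n → ℝ}
    (hx : x ∈ posOrthant (Fin n)) :
    ∑ p : Fin n × Fin n, ∑ q : Fin n × Fin n, dualForm n p.1 p.2 * (dualForm n q.1 q.2 *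
      iterPartialDeriv [q.2, q.1, p.2, p.1] (fun x : Fin n → ℝ => E2 n x ^ s) x) =
      s * (n - 2 + 2 * s) * ((s - 1) * (n - 2 + 2 * (s - 1)) * E2 n x ^ (s - 2)) := by
  set f : ℝ → (Fin n → ℝ) → ℝ := fun s x => E2 n x ^ s with hf
  have h1 : ∀ q : Fin n × Fin n, ∑ p : Fin n × Fin n, dualForm n p.1 p.2 *
      iterPartialDeriv [q.2, q.1, p.2, p.1] (f s) x =
      s * (n - 2 + 2 * s) * iterPartialDeriv [q.2, q.1] (f (s - 1)) x := by
    intro q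
    have h2 := iterPartialDeriv_sum (Finset.univ : Finset (Fin n × Fin n))
      (fun p => dualForm n p.1 p.2) (fun p => iterPartialDeriv [p.2, p.1] (f s))
      (fun p => (smoothOnOrthant_E2_rpow hn s).iterPartialDeriv _) [q.2, q.1] hx
    have h3 := iterPartialDeriv_sum (Finset.univ : Finset Unit)
      (fun _ => s * (n - 2 + 2 * s)) (fun _ => f (s - 1))
      (fun _ => smoothOnOrthant_E2_rpow hn (s - 1)) [q.2, q.1] hx
    simp only [Finset.univ_unique, Finset.sum_singleton] at h3
    rw [← h3]
    refine h2.symm.trans (iterPartialDeriv_congr (fun y hy => ?_) _ hx)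
    exact sum_dualForm_partialDeriv_E2_rpow hn s hy
  rw [Finset.sum_comm]
  have h4 : ∀ q : Fin n × Fin n, ∑ p : Fin n × Fin n, dualForm n p.1 p.2 *
      (dualForm n q.1 q.2 * iterPartialDeriv [q.2, q.1, p.2, p.1] (f s) x) =
      s * (n - 2 + 2 * s) * (dualForm n q.1 q.2 *
        iterPartialDeriv [q.2, q.1] (f (s - 1)) x) := by
    intro q
    rw [mul_left_comm, ← h1 q, Finset.mul_sum]
    exact Finset.sum_congr rfl fun p _ => by ring
  rw [Finset.sum_congr rfl fun q _ => h4 q, ← Finset.mul_sum,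
    sum_dualForm_partialDeriv_E2_rpow hn (s - 1) hx, show s - 1 - 1 = s - 2 by ring]

theorem not_diffMonotone_E2_rpow_of_window {n : ℕ} (hn : 2 ≤ n) {β : ℝ} (h0 : 0 < β)
    (h1 : ((n : ℝ) - 3) / 2 ≤ β) (h2 : β < ((n : ℝ) - 2) / 2) :
    ¬ DiffMonotone (fun x : Fin n → ℝ => E2 n x ^ (-β)) := by
  intro hf
  have hx : (fun _ => 1 : Fin n → ℝ) ∈ posOrthant (Fin n) := fun _ => one_pos
  have h := hf.sum_iterPartialDeriv_nonneg (smoothOnOrthant_E2_rpow hn _) (dualForm n) hx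
  rw [sum_sum_dualForm_E2_rpow hn (-β) hx] at h
  have hE := Real.rpow_pos_of_pos (E2_pos hn hx) (-β - 2)
  have h3 : 0 < β * (n - 2 + 2 * -β) := mul_pos h0 (by linarith)
  have h4 : 0 < (β + 1) * -(n - 2 + 2 * (-β - 1)) := mul_pos (by linarith) (by linarith)
  nlinarith [mul_pos (mul_pos h3 h4) hE]

theorem snoc_mem_posOrthant {n : ℕ} {y : Fin n → ℝ} (hy : y ∈ posOrthant (Fin n)) {t : ℝ}
    (ht : 0 < t) : (Fin.snoc y t : Fin (n + 1) → ℝ) ∈ posOrthant (Fin (n + 1)) := by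
  intro i
  refine Fin.lastCases ?_ (fun j => ?_) i
  · simpa using ht
  · simpa using hy j

theorem DiffNonneg.snoc {n k : ℕ} {f : (Fin (n + 1) → ℝ) → ℝ} (hf : DiffNonneg k f) {t : ℝ}
    (ht : 0 < t) : DiffNonneg k (fun y : Fin n → ℝ => f (Fin.snoc y t)) := by
  induction k generalizing f with
  | zero => exact fun y hy => hf _ (snoc_mem_posOrthant hy ht)
  | succ k ih =>
    intro i h hh
    refine (ih (hf i.castSucc h hh)).congr fun y _ => ?_
    change f _ - f _ = f _ - f _
    congr 2
    ext j
    refine Fin.lastCases ?_ (fun j => ?_) j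
    · simp [(Fin.castSucc_ne_last i).symm]
    · simp [Pi.single_apply]

theorem DiffMonotone.E2_rpow_pred {n : ℕ} (hn : 2 ≤ n) {s : ℝ}
    (hf : DiffMonotone (fun x : Fin (n + 1) → ℝ => E2 (n + 1) x ^ s)) :
    DiffMonotone (fun x : Fin n → ℝ => E2 n x ^ s) := by
  intro k
  refine DiffNonneg.of_tendsto (l := 𝓝[>] (0 : ℝ))
    (F := fun t y => E2 (n + 1) (Fin.snoc y t) ^ s) ?_ fun y hy => ?_
  · filter_upwards [self_mem_nhdsWithin] with t ht using (hf k).snoc ht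
  · simp only [E2_snoc]
    have h1 : ContinuousAt (fun t : ℝ => (E2 n y + t * ∑ i, y i) ^ s) 0 :=
      ContinuousAt.rpow_const (by fun_prop) (Or.inl (by simpa using (E2_pos hn hy).ne'))
    have h2 : Tendsto _ _ _ := h1.tendsto
    rw [zero_mul, add_zero] at h2
    exact h2.mono_left nhdsWithin_le_nhds

theorem not_diffMonotone_E2_rpow {n : ℕ} (hn : 2 ≤ n) {β : ℝ} (h0 : 0 < β)
    (h2 : β < ((n : ℝ) - 2) / 2) : ¬ DiffMonotone (fun x : Fin n → ℝ => E2 n x ^ (-β)) := by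
  induction n, hn using Nat.le_induction with
  | base => norm_num at h2; linarith
  | succ n hn ih =>
    by_cases h1 : ((n + 1 : ℕ) - 3 : ℝ) / 2 ≤ β
    · exact not_diffMonotone_E2_rpow_of_window (by omega) h0 h1 h2
    · refine fun hf => ih ?_ (hf.E2_rpow_pred hn)
      push_cast at h1
      linarith

theorem not_diffMonotone_E2_rpow_of_pos {n : ℕ} (hn : 2 ≤ n) {s : ℝ} (hs : 0 < s) :
    ¬ DiffMonotone (fun x : Fin n → ℝ => E2 n x ^ s) := by
  intro hf
  have hx : (fun _ => 1 : Fin n → ℝ) ∈ posOrthant (Fin n) := fun _ => one_pos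
  have h := (hf.backDiff one_pos ⟨0, by omega⟩).nonneg hx
  change 0 ≤ _ - E2 n (_ + Pi.single _ 1) ^ s at h
  rw [E2_add_single] at h
  have hn' : (2 : ℝ) ≤ n := by exact_mod_cast hn
  have h1 := Real.rpow_lt_rpow (E2_pos hn hx).le
    (lt_add_of_pos_right (E2 n fun _ => 1) (show (0 : ℝ) < 1 * (∑ _j : Fin n, 1 - 1) by
      simp; linarith)) hs
  linarith

end ElementarySymmetric

section Sufficiency

theorem exists_simplex_vectors (d : ℕ) :
    ∃ v : Fin (d + 1) → EuclideanSpace ℝ (Fin d), ∀ x : Fin (d + 1) → ℝ,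
      ‖∑ i, x i • v i‖ ^ 2 = ∑ i, x i ^ 2 - (∑ i, x i) ^ 2 / (d + 1) := by
  set e : EuclideanSpace ℝ (Fin (d + 1)) := WithLp.toLp 2 fun _ => 1 with he
  have he0 : e ≠ 0 := fun h => by
    have := congrArg (fun u : EuclideanSpace ℝ (Fin (d + 1)) => u 0) h
    simp [he] at this
  have hfact : Fact (Module.finrank ℝ (EuclideanSpace ℝ (Fin (d + 1))) = d + 1) := ⟨by simp⟩
  let φ := (OrthonormalBasis.fromOrthogonalSpanSingleton (𝕜 := ℝ) d he0).repr
  let P := (Submodule.span ℝ {e})ᗮ.orthogonalProjectionOnto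
  refine ⟨fun i => φ (P (EuclideanSpace.single i 1)), fun x => ?_⟩
  have h1 : ∑ i, x i • φ (P (EuclideanSpace.single i 1)) = φ (P (WithLp.toLp 2 x)) := by
    have : WithLp.toLp 2 x = ∑ i, x i • EuclideanSpace.single i (1 : ℝ) := by
      ext j
      simp [Pi.single_apply]
    rw [this]
    simp only [map_sum, map_smul]
  rw [h1, LinearIsometryEquiv.norm_map]
  have h2 := Submodule.norm_sq_eq_add_norm_sq_starProjection (WithLp.toLp 2 x)
    (Submodule.span ℝ {e})
  have h3 : ‖(Submodule.span ℝ {e})ᗮ.starProjection (WithLp.toLp 2 x)‖ =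
    ‖P (WithLp.toLp 2 x)‖ := rfl
  have h4 : ‖e‖ ^ 2 = d + 1 := by simp [he, EuclideanSpace.norm_sq_eq]
  have h5 : inner ℝ e (WithLp.toLp 2 x) = ∑ i, x i := by simp [he, PiLp.inner_apply]
  rw [h3, Submodule.starProjection_singleton, h5, norm_smul, mul_pow, h4] at h2
  have hd : (d : ℝ) + 1 ≠ 0 := by positivity
  have h6 : ‖(WithLp.toLp 2 x : EuclideanSpace ℝ (Fin (d + 1)))‖ ^ 2 = ∑ i, x i ^ 2 := by
    simp [EuclideanSpace.norm_sq_eq]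
  rw [h6] at h2
  rw [h2]
  simp only [RCLike.ofReal_real_eq_id, id, Real.norm_eq_abs, sq_abs]
  field_simp
  ring

theorem integral_exp_neg_mul_sq_norm_sub_inner {V : Type*} [NormedAddCommGroup V]
    [InnerProductSpace ℝ V] [FiniteDimensional ℝ V] [MeasurableSpace V] [BorelSpace V]
    {b : ℝ} (hb : 0 < b) (w : V) :
    ∫ y : V, Real.exp (-b * ‖y‖ ^ 2 - inner ℝ w y) =
      (Real.pi / b) ^ (Module.finrank ℝ V / 2 : ℝ) * Real.exp (‖w‖ ^ 2 / (4 * b)) := by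
  have h := GaussianFourier.integral_cexp_neg_mul_sq_norm_add (V := V) (b := (b : ℂ))
    (by simpa using hb) (-1) w
  have h1 : ∀ y : V, Complex.exp (-(b : ℂ) * (‖y‖ : ℂ) ^ 2 + -1 * ((inner ℝ w y : ℝ) : ℂ)) =
      ((Real.exp (-b * ‖y‖ ^ 2 - inner ℝ w y) : ℝ) : ℂ) := by
    intro y
    push_cast
    congr 1
    ring
  simp only [h1] at h
  rw [integral_complex_ofReal] at h
  have h2 : ((Real.pi : ℂ) / b) ^ (Module.finrank ℝ V / 2 : ℂ) =
      (((Real.pi / b) ^ (Module.finrank ℝ V / 2 : ℝ) : ℝ) : ℂ) := by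
    rw [Complex.ofReal_cpow (by positivity)]
    push_cast
    rfl
  rw [h2] at h
  apply Complex.ofReal_injective
  rw [h]
  push_cast
  norm_num

/-- The function `exp (-s E_2 / ∑ x)` is, up to the factor `(2 π s / ∑ x) ^ (d / 2)`, a mixture of
exponentials of nonnegative linear forms. -/
theorem integral_exp_neg_sum_simplex {d : ℕ} {v : Fin (d + 1) → EuclideanSpace ℝ (Fin d)}
    (hv : ∀ x : Fin (d + 1) → ℝ,
      ‖∑ i, x i • v i‖ ^ 2 = ∑ i, x i ^ 2 - (∑ i, x i) ^ 2 / (d + 1))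
    {s : ℝ} (hs : 0 < s) {x : Fin (d + 1) → ℝ} (hx : 0 < ∑ i, x i) :
    ∫ y, Real.exp (-∑ i, x i * (‖y + s • v i‖ ^ 2 / (2 * s))) =
      (2 * Real.pi * s / ∑ i, x i) ^ (d / 2 : ℝ) *
        Real.exp (-(s * (E2 (d + 1) x / ∑ i, x i))) := by
  set L := ∑ i, x i with hL
  have hd : (d : ℝ) + 1 ≠ 0 := by positivity
  have hvi : ∀ i, ‖v i‖ ^ 2 = 1 - 1 / (d + 1) := by
    intro i
    have := hv (Pi.single i 1)
    simpa [Pi.single_apply, ite_smul] using this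
  have h1 : ∀ y, -∑ i, x i * (‖y + s • v i‖ ^ 2 / (2 * s)) =
      (-(L / (2 * s)) * ‖y‖ ^ 2 - inner ℝ (∑ i, x i • v i) y) +
        -(s * L * (1 - 1 / (d + 1)) / 2) := by
    intro y
    have h2 : ∀ i, x i * (‖y + s • v i‖ ^ 2 / (2 * s)) =
        x i * (‖y‖ ^ 2 / (2 * s)) + x i * inner ℝ (v i) y +
          x i * (s * (1 - 1 / (d + 1)) / 2) := by
      intro i
      rw [norm_add_sq_real, norm_smul, mul_pow, hvi, inner_smul_right, Real.norm_eq_abs, sq_abs,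
        real_inner_comm]
      field_simp
    simp only [h2, Finset.sum_add_distrib, ← Finset.sum_mul, ← hL, sum_inner,
      real_inner_smul_left]
    ring
  simp only [h1, Real.exp_add]
  rw [integral_mul_const, integral_exp_neg_mul_sq_norm_sub_inner (by positivity), hv, ← hL, E2_eq,
    ← hL, mul_assoc, ← Real.exp_add, finrank_euclideanSpace_fin]
  congr 2
  · field_simp
  · field_simp
    ring

theorem diffMonotone_sum_rpow_neg {ι : Type*} [Fintype ι] [DecidableEq ι] {a : ι → ℝ}
    (ha : ∀ i, 0 ≤ a i) (hpos : ∀ x ∈ posOrthant ι, 0 < ∑ i, x i * a i) {γ : ℝ} (hγ : 0 ≤ γ) :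
    DiffMonotone (fun x : ι → ℝ => (∑ i, x i * a i) ^ (-γ)) := by
  rcases hγ.eq_or_lt with rfl | hγ
  · exact (diffMonotone_const zero_le_one).congr fun x _ => by simp
  have key : ∀ x ∈ posOrthant ι,
      ∫ t in Set.Ioi (0 : ℝ), t ^ (γ - 1) * Real.exp (-∑ i, x i * (t * a i)) =
        (∑ i, x i * a i) ^ (-γ) * Real.Gamma γ := by
    intro x hx
    have h := Real.integral_rpow_mul_exp_neg_mul_Ioi hγ (hpos x hx)
    rw [one_div, Real.inv_rpow (hpos x hx).le, ← Real.rpow_neg (hpos x hx).le, mul_comm _ γ.Gamma,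
      mul_comm γ.Gamma] at h
    rw [← h]
    refine integral_congr_ae (.of_forall fun t => ?_)
    simp only [Finset.sum_mul]
    congr 3
    exact Finset.sum_congr rfl fun i _ => by ring
  have hG := Real.Gamma_pos_of_pos hγ
  have hF : DiffMonotone (fun x : ι → ℝ =>
      ∫ t in Set.Ioi (0 : ℝ), t ^ (γ - 1) * Real.exp (-∑ i, x i * (t * a i))) := by
    refine DiffMonotone.integral (ae_restrict_of_forall_mem measurableSet_Ioi fun t ht => ?_)
      fun x hx => .of_integral_ne_zero ?_
    · exact (diffMonotone_exp_neg_sum fun i => mul_nonneg (le_of_lt ht) (ha i)).smul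
        (Real.rpow_nonneg (le_of_lt ht) _)
    · rw [key x hx]
      exact (mul_pos (Real.rpow_pos_of_pos (hpos x hx) _) hG).ne'
  refine (hF.smul (inv_nonneg.2 hG.le)).congr fun x hx => ?_
  rw [Pi.smul_apply, key x hx, smul_eq_mul]
  field_simp

theorem diffMonotone_E2_rpow_neg_kernel {d : ℕ} {β : ℝ} (hβ : (d : ℝ) / 2 ≤ β) {s : ℝ}
    (hs : 0 < s) :
    DiffMonotone (fun x : Fin (d + 2) → ℝ => s ^ (β - 1) *
      Real.exp (-((E2 (d + 2) x / ∑ i : Fin (d + 1), x i.castSucc) * s)) *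
        (∑ i : Fin (d + 1), x i.castSucc) ^ (-β)) := by
  obtain ⟨v, hv⟩ := exists_simplex_vectors d
  have hL : ∀ x ∈ posOrthant (Fin (d + 2)), 0 < ∑ i : Fin (d + 1), x i.castSucc := fun x hx =>
    Finset.sum_pos (fun i _ => hx _) Finset.univ_nonempty
  let a : EuclideanSpace ℝ (Fin d) → Fin (d + 2) → ℝ := fun y =>
    Fin.snoc (α := fun _ => ℝ) (fun i => ‖y + s • v i‖ ^ 2 / (2 * s)) s
  have key : ∀ x ∈ posOrthant (Fin (d + 2)), ∫ y, Real.exp (-∑ i, x i * a y i) =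
      (2 * Real.pi * s) ^ (d / 2 : ℝ) * (∑ i : Fin (d + 1), x i.castSucc) ^ (-(d / 2 : ℝ)) *
        Real.exp (-((E2 (d + 2) x / ∑ i : Fin (d + 1), x i.castSucc) * s)) := by
    intro x hx
    have hLx := hL x hx
    have h1 := integral_exp_neg_sum_simplex hv hs (x := fun i => x i.castSucc) hLx
    have h2 : E2 (d + 2) x = E2 (d + 1) (fun i => x i.castSucc) +
        x (Fin.last _) * ∑ i : Fin (d + 1), x i.castSucc := by
      rw [← E2_snoc]
      exact congrArg _ (Fin.snoc_init_self x).symm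
    simp only [a, Fin.sum_univ_castSucc (n := d + 1), Fin.snoc_castSucc, Fin.snoc_last, neg_add,
      Real.exp_add]
    rw [integral_mul_const, h1, mul_assoc, ← Real.exp_add, Real.div_rpow (by positivity) hLx.le,
      Real.rpow_neg hLx.le, h2, div_eq_mul_inv]
    congr 2
    field_simp
    ring
  have hC : (0 : ℝ) < (2 * Real.pi * s) ^ (d / 2 : ℝ) := by positivity
  have hF : DiffMonotone (fun x : Fin (d + 2) → ℝ => ∫ y, Real.exp (-∑ i, x i * a y i)) := by
    refine DiffMonotone.integral (.of_forall fun y => diffMonotone_exp_neg_sum fun i => ?_)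
      fun x hx => .of_integral_ne_zero ?_
    · refine Fin.lastCases ?_ (fun i => ?_) i
      · simpa [a] using hs.le
      · simp only [a, Fin.snoc_castSucc]
        positivity
    · rw [key x hx]
      have := Real.rpow_pos_of_pos (hL x hx) (-(d / 2 : ℝ))
      positivity
  have hsum : ∀ x : Fin (d + 2) → ℝ,
      ∑ i, x i * (Fin.snoc (α := fun _ => ℝ) (fun _ => 1) 0 : Fin (d + 2) → ℝ) i =
        ∑ i : Fin (d + 1), x i.castSucc := by
    intro x
    rw [Fin.sum_univ_castSucc]
    simp
  have hG := diffMonotone_sum_rpow_neg (a := (Fin.snoc (α := fun _ => ℝ) (fun _ => 1) 0))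
    (fun i => Fin.lastCases (by simp) (fun i => by simp) i)
    (fun x hx => by rw [hsum]; exact hL x hx) (sub_nonneg.2 hβ)
  simp only [hsum] at hG
  refine ((hF.mul hG).smul (c := s ^ (β - 1) * ((2 * Real.pi * s) ^ (d / 2 : ℝ))⁻¹)
    (by positivity)).congr fun x hx => ?_
  have h3 : (∑ i : Fin (d + 1), x i.castSucc) ^ (-β) =
      (∑ i : Fin (d + 1), x i.castSucc) ^ (-(d / 2 : ℝ)) *
        (∑ i : Fin (d + 1), x i.castSucc) ^ (-(β - d / 2)) := by
    rw [← Real.rpow_add (hL x hx)]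
    congr 1
    ring
  rw [Pi.smul_apply, Pi.mul_apply, key x hx, h3, smul_eq_mul]
  field_simp

theorem diffMonotone_E2_rpow_neg {d : ℕ} {β : ℝ} (h0 : 0 < β) (hβ : (d : ℝ) / 2 ≤ β) :
    DiffMonotone (fun x : Fin (d + 2) → ℝ => E2 (d + 2) x ^ (-β)) := by
  have hL : ∀ x ∈ posOrthant (Fin (d + 2)), 0 < ∑ i : Fin (d + 1), x i.castSucc := fun x hx =>
    Finset.sum_pos (fun i _ => hx _) Finset.univ_nonempty
  have hE : ∀ x ∈ posOrthant (Fin (d + 2)), 0 < E2 (d + 2) x := fun x hx =>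
    E2_pos (Nat.le_add_left 2 d) hx
  have key : ∀ x ∈ posOrthant (Fin (d + 2)), ∫ s in Set.Ioi (0 : ℝ), s ^ (β - 1) *
      Real.exp (-((E2 (d + 2) x / ∑ i : Fin (d + 1), x i.castSucc) * s)) *
        (∑ i : Fin (d + 1), x i.castSucc) ^ (-β) = Real.Gamma β * E2 (d + 2) x ^ (-β) := by
    intro x hx
    have hLx := hL x hx
    have hEx := hE x hx
    have hLβ := Real.rpow_pos_of_pos hLx β
    rw [integral_mul_const, Real.integral_rpow_mul_exp_neg_mul_Ioi h0 (div_pos hEx hLx),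
      one_div_div, Real.div_rpow hLx.le hEx.le, Real.rpow_neg hLx.le, Real.rpow_neg hEx.le]
    field_simp
  have hG := Real.Gamma_pos_of_pos h0
  have hF := DiffMonotone.integral (μ := volume.restrict (Set.Ioi (0 : ℝ)))
    (ae_restrict_of_forall_mem measurableSet_Ioi fun s hs =>
      diffMonotone_E2_rpow_neg_kernel hβ (Set.mem_Ioi.1 hs))
    fun x hx => .of_integral_ne_zero (by
      rw [key x hx]
      exact (mul_pos hG (Real.rpow_pos_of_pos (hE x hx) _)).ne')
  refine (hF.smul (inv_nonneg.2 hG.le)).congr fun x hx => ?_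
  rw [Pi.smul_apply, key x hx, smul_eq_mul, inv_mul_cancel_left₀ hG.ne']

end Sufficiency

/-- For `n ≥ 2`, the function `E_{2,n}^{-β}` is completely monotone on
`(0,∞)^n` iff `β = 0` or `β ≥ (n−2)/2`. -/
theorem inverse_power_E2n_completely_monotone_iff (n : ℕ) (hn : 2 ≤ n) (β : ℝ) :
    CompletelyMonotoneOnOrthant (fun x : Fin n → ℝ => E2 n x ^ (-β))
      ↔ (β = 0 ∨ ((n : ℝ) - 2) / 2 ≤ β) := by
  constructor
  · intro hf
    by_contra! h
    rcases lt_or_gt_of_ne h.1 with h1 | h1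
    · exact not_diffMonotone_E2_rpow_of_pos hn (neg_pos.2 h1) hf.diffMonotone
    · exact not_diffMonotone_E2_rpow hn h1 h.2 hf.diffMonotone
  · intro h
    refine DiffMonotone.completelyMonotoneOnOrthant ?_ (smoothOnOrthant_E2_rpow hn _)
    by_cases h0 : β = 0
    · exact (diffMonotone_const zero_le_one).congr fun x _ => by simp [h0]
    obtain ⟨d, rfl⟩ : ∃ d, n = d + 2 := ⟨n - 2, by omega⟩
    have hβ : (d : ℝ) / 2 ≤ β := by
      have := h.resolve_left h0
      push_cast at this
      linarith
    exact diffMonotone_E2_rpow_neg (lt_of_le_of_ne (le_trans (by positivity) hβ) (Ne.symm h0)) hβ
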